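/- Let G=(V,E) be a correlation clustering instance and β∈(0,1), and let x be the fractional solution built from the pruned graph H. For every clustering 𝒞 and every k∈[n], cost^k_x ≤ (1 + 4/β + 2/(1−β))·cost^k_𝒞. In particular, taking β = 0.5858, x is a feasible solution to the metric LP and for every k∈[n], cost^k_x ≤ 12.66·opt^k, where opt^k is the minimum of cost^k_𝒞 over all clusterings 𝒞 of V. -/

import Mathlib

open Finset

attribute [local instance] Classical.propDecidable

noncomputable section

variable {V : Type*}

/-- The neighborhood of `u` in the graph of `+`edges `E` (contains `u` itself,
since `E` contains all self-loops). -/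
def Nbr [Fintype V] (E : V → V → Prop) (u : V) : Finset V :=
  Finset.univ.filter (fun v => E u v)

/-- The degree `d(u) = |N(u)|`. -/
def deg [Fintype V] (E : V → V → Prop) (u : V) : ℕ := (Nbr E u).card

/-- `M_{uv} = max (d(u), d(v))`. -/
def Mdeg [Fintype V] (E : V → V → Prop) (u v : V) : ℕ := max (deg E u) (deg E v)

/-- The pruned edge set `E_H = {uv ∈ E : |N(u) Δ N(v)| ≤ β · M_{uv}}`. -/
def EH [Fintype V] (β : ℝ) (E : V → V → Prop) (u v : V) : Prop :=
  E u v ∧ ((symmDiff (Nbr E u) (Nbr E v)).card : ℝ) ≤ β * (Mdeg E u v : ℝ)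

/-- The neighborhood of `u` in the pruned graph `H`. -/
def NH [Fintype V] (β : ℝ) (E : V → V → Prop) (u : V) : Finset V :=
  Finset.univ.filter (fun v => EH β E u v)

/-- The fractional solution: `x_{uu} = 0` and
`x_{uv} = 1 − |N_H(u) ∩ N_H(v)| / M_{uv}` for `u ≠ v`. -/
def xval [Fintype V] (β : ℝ) (E : V → V → Prop) (u v : V) : ℝ :=
  if u = v then 0 else 1 - ((NH β E u ∩ NH β E v).card : ℝ) / (Mdeg E u v : ℝ)

/-- `cost_𝒞(u)`: the number of pairs incident to `u` in disagreement with respect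
to the clustering `C` (given as a labelling function). -/
def costC [Fintype V] {α : Type*} (E : V → V → Prop) (C : V → α) (u : V) : ℕ :=
  (Finset.univ.filter
    (fun v => (E u v ∧ C u ≠ C v) ∨ (¬ E u v ∧ v ≠ u ∧ C u = C v))).card

/-- The top-`k` norm `cost^k_𝒞` of the disagreement vector of the clustering `C`:
the maximum of `∑_{u ∈ T} cost_𝒞(u)` over subsets `T ⊆ V` of size `k`. -/
def costTopK [Fintype V] {α : Type*} (E : V → V → Prop) (C : V → α) (k : ℕ) : ℕ :=
  (Finset.powersetCard k (Finset.univ : Finset V)).sup (fun T => ∑ u ∈ T, costC E C u)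

/-- The fractional disagreement `cost_x(u) = Σ_{v : uv∈E} x_{uv} + Σ_{v≠u, uv∉E} (1−x_{uv})`. -/
def costX [Fintype V] (E : V → V → Prop) (x : V → V → ℝ) (u : V) : ℝ :=
  (∑ v ∈ Finset.univ.filter (fun v => E u v), x u v)
    + ∑ v ∈ Finset.univ.filter (fun v => v ≠ u ∧ ¬ E u v), (1 - x u v)

/-- The top-`k` norm `cost^k_x` of the fractional disagreement vector:
the maximum of `Σ_{u∈T} cost_x(u)` over subsets `T ⊆ V` with `|T| = k`. -/
def costXTopK [Fintype V] (E : V → V → Prop) (x : V → V → ℝ) (k : ℕ) : ℝ :=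
  if h : (Finset.powersetCard k (Finset.univ : Finset V)).Nonempty then
    (Finset.powersetCard k (Finset.univ : Finset V)).sup' h (fun T => ∑ u ∈ T, costX E x u)
  else 0

section ChargeMatrices

variable [Fintype V]

/-- A nonnegative matrix all of whose row and column sums are at most `c`. -/
structure IsChargeMatrix (F : Matrix V V ℝ) (c : ℝ) : Prop where
  nonneg : ∀ u v, 0 ≤ F u v
  row_le : ∀ u, ∑ v, F u v ≤ c
  col_le : ∀ v, ∑ u, F u v ≤ c

theorem IsChargeMatrix.add {F G : Matrix V V ℝ} {c d : ℝ} (hF : IsChargeMatrix F c)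
    (hG : IsChargeMatrix G d) : IsChargeMatrix (F + G) (c + d) where
  nonneg u v := add_nonneg (hF.nonneg u v) (hG.nonneg u v)
  row_le u := by
    simpa [sum_add_distrib] using add_le_add (hF.row_le u) (hG.row_le u)
  col_le v := by
    simpa [sum_add_distrib] using add_le_add (hF.col_le v) (hG.col_le v)

theorem IsChargeMatrix.smul {F : Matrix V V ℝ} {c a : ℝ} (ha : 0 ≤ a)
    (hF : IsChargeMatrix F c) : IsChargeMatrix (a • F) (a * c) where
  nonneg u v := mul_nonneg ha (hF.nonneg u v)
  row_le u := by
    simpa [← mul_sum] using mul_le_mul_of_nonneg_left (hF.row_le u) ha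
  col_le v := by
    simpa [← mul_sum] using mul_le_mul_of_nonneg_left (hF.col_le v) ha

theorem isChargeMatrix_one : IsChargeMatrix (1 : Matrix V V ℝ) 1 where
  nonneg u v := by rw [Matrix.one_apply]; split_ifs <;> norm_num
  row_le u := by simp [Matrix.one_apply]
  col_le v := by simp [Matrix.one_apply]

/-- The matrix acting by `y ↦ (u ↦ ∑ v, K u v * (y u + y v))`. -/
def signlessLap (K : Matrix V V ℝ) : Matrix V V ℝ :=
  Matrix.diagonal (fun u => ∑ v, K u v) + K

theorem signlessLap_mulVec (K : Matrix V V ℝ) (y : V → ℝ) (u : V) :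
    (signlessLap K).mulVec y u = ∑ v, K u v * (y u + y v) := by
  rw [signlessLap, Matrix.add_mulVec, Pi.add_apply, Matrix.mulVec_diagonal]
  simp only [Matrix.mulVec, dotProduct, mul_add, sum_add_distrib, sum_mul]

theorem signlessLap_nonneg {K : Matrix V V ℝ} (hK : ∀ u v, 0 ≤ K u v) (u v : V) :
    0 ≤ signlessLap K u v := by
  rw [signlessLap, Matrix.add_apply, Matrix.diagonal_apply]
  have := sum_nonneg (fun w (_ : w ∈ univ) => hK u w)
  split_ifs <;> linarith [hK u v]

theorem signlessLap_symm {K : Matrix V V ℝ} (hK : ∀ u v, K u v = K v u) (u v : V) :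
    signlessLap K u v = signlessLap K v u := by
  simp only [signlessLap, Matrix.add_apply, Matrix.diagonal_apply]
  rw [hK u v]
  by_cases h : u = v
  · subst h; rfl
  · rw [if_neg h, if_neg (Ne.symm h)]

theorem signlessLap_row_sum (K : Matrix V V ℝ) (u : V) :
    ∑ v, signlessLap K u v = 2 * ∑ v, K u v := by
  have h := signlessLap_mulVec K (fun _ => 1) u
  simp only [Matrix.mulVec, dotProduct, mul_one, ← sum_mul] at h
  rw [h]; ring

theorem signlessLap_mul_row_sum_le {K L : Matrix V V ℝ} (hK : ∀ u v, 0 ≤ K u v)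
    (hL : ∀ u v, 0 ≤ L u v) (hKL : ∀ u, ∑ v, K u v + ∑ v, L u v ≤ 1) (u : V) :
    ∑ w, (signlessLap K * signlessLap L) u w ≤ 2 := by
  have hK0 : ∀ u, 0 ≤ ∑ v, K u v := fun u => sum_nonneg fun v _ => hK u v
  have hL0 : ∀ u, 0 ≤ ∑ v, L u v := fun u => sum_nonneg fun v _ => hL u v
  have h1 : ∑ w, (signlessLap K * signlessLap L) u w
      = ∑ v, K u v * (2 * ∑ w, L u w + 2 * ∑ w, L v w) := by
    rw [← signlessLap_mulVec K (fun v => 2 * ∑ w, L v w) u]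
    simp only [Matrix.mul_apply, Matrix.mulVec, dotProduct]
    rw [sum_comm]
    refine sum_congr rfl fun v _ => ?_
    rw [← mul_sum, signlessLap_row_sum]
  have h2 : ∑ v, K u v * (2 * ∑ w, L u w + 2 * ∑ w, L v w)
      ≤ ∑ v, K u v * (2 * ∑ w, L u w + 2) := by
    refine sum_le_sum fun v _ => mul_le_mul_of_nonneg_left ?_ (hK u v)
    linarith [hKL v, hK0 v]
  rw [h1]
  refine h2.trans ?_
  rw [← sum_mul]
  nlinarith [hKL u, hK0 u, hL0 u, sq_nonneg (∑ w, L u w)]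

theorem isChargeMatrix_signlessLap_add {K L : Matrix V V ℝ} (hK : ∀ u v, 0 ≤ K u v)
    (hL : ∀ u v, 0 ≤ L u v) (hKs : ∀ u v, K u v = K v u) (hLs : ∀ u v, L u v = L v u)
    (hKL : ∀ u, ∑ v, K u v + ∑ v, L u v ≤ 1) :
    IsChargeMatrix (signlessLap K + signlessLap L) 2 := by
  have hrow : ∀ u, ∑ v, (signlessLap K + signlessLap L) u v ≤ 2 := fun u => by
    simp only [Matrix.add_apply, sum_add_distrib, signlessLap_row_sum]
    linarith [hKL u]
  refine ⟨fun u v => add_nonneg (signlessLap_nonneg hK u v) (signlessLap_nonneg hL u v), hrow,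
    fun v => ?_⟩
  refine le_of_eq_of_le (sum_congr rfl fun u _ => ?_) (hrow v)
  rw [Matrix.add_apply, Matrix.add_apply, signlessLap_symm hKs, signlessLap_symm hLs]

theorem isChargeMatrix_signlessLap_mul {K L : Matrix V V ℝ} (hK : ∀ u v, 0 ≤ K u v)
    (hL : ∀ u v, 0 ≤ L u v) (hKs : ∀ u v, K u v = K v u) (hLs : ∀ u v, L u v = L v u)
    (hKL : ∀ u, ∑ v, K u v + ∑ v, L u v ≤ 1) :
    IsChargeMatrix (signlessLap K * signlessLap L) 2 := by
  refine ⟨fun u v => ?_, signlessLap_mul_row_sum_le hK hL hKL, fun v => ?_⟩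
  · rw [Matrix.mul_apply]
    exact sum_nonneg fun w _ => mul_nonneg (signlessLap_nonneg hK _ _) (signlessLap_nonneg hL _ _)
  · refine le_of_eq_of_le (sum_congr rfl fun u _ => ?_)
      (signlessLap_mul_row_sum_le hL hK (fun u => by linarith [hKL u]) v)
    rw [Matrix.mul_apply, Matrix.mul_apply]
    refine sum_congr rfl fun w _ => ?_
    rw [signlessLap_symm hKs u w, signlessLap_symm hLs w v, mul_comm]

/-- Fractional weights `a ≤ c` of total mass at most `c * k` collect at most `c` times the sum
of `y` over some `k`-element set. -/
theorem exists_card_eq_sum_mul_le (a y : V → ℝ) {c : ℝ} {k : ℕ} (hk : 1 ≤ k)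
    (hkn : k ≤ Fintype.card V) (hac : ∀ z, a z ≤ c) (ha : ∀ z, 0 ≤ a z)
    (hsum : ∑ z, a z ≤ c * k) (hy : ∀ z, 0 ≤ y z) :
    ∃ S : Finset V, S.card = k ∧ ∑ z, a z * y z ≤ c * ∑ z ∈ S, y z := by
  have hne : (powersetCard k (univ : Finset V)).Nonempty :=
    powersetCard_nonempty.2 (by simpa using hkn)
  obtain ⟨S, hS, hmax⟩ := exists_max_image _ (fun S => ∑ z ∈ S, y z) hne
  have hSk : S.card = k := (mem_powersetCard.1 hS).2
  have hSne : S.Nonempty := card_pos.1 (by omega)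
  obtain ⟨m, hmS, hm⟩ := exists_min_image S y hSne
  have hout : ∀ z, z ∉ S → y z ≤ y m := by
    intro z hz
    have hz' : z ∉ S.erase m := fun h => hz (mem_of_mem_erase h)
    have hmem : insert z (S.erase m) ∈ powersetCard k (univ : Finset V) := by
      rw [mem_powersetCard]
      refine ⟨subset_univ _, ?_⟩
      rw [card_insert_of_notMem hz', card_erase_of_mem hmS]
      omega
    have h := hmax _ hmem
    simp only [sum_insert hz'] at h
    have := add_sum_erase S y hmS
    linarith
  refine ⟨S, hSk, ?_⟩
  have hpt : ∀ z, a z * y z ≤ a z * y m + if z ∈ S then c * (y z - y m) else 0 := by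
    intro z
    split_ifs with hz
    · nlinarith [hac z, hm z hz]
    · nlinarith [ha z, hout z hz]
  calc ∑ z, a z * y z
      ≤ ∑ z, (a z * y m + if z ∈ S then c * (y z - y m) else 0) := sum_le_sum fun z _ => hpt z
    _ = (∑ z, a z) * y m + c * (∑ z ∈ S, y z - k * y m) := by
        rw [sum_add_distrib, ← sum_mul, sum_ite_mem, univ_inter, ← mul_sum, sum_sub_distrib,
          sum_const, hSk, nsmul_eq_mul]
    _ ≤ c * ∑ z ∈ S, y z := by nlinarith [hy m]

theorem IsChargeMatrix.sum_mulVec_le_costTopK {E : V → V → Prop} {C : V → ℕ}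
    {F : Matrix V V ℝ} {c : ℝ} (hF : IsChargeMatrix F c) (hc : 0 ≤ c) {k : ℕ} (hk : 1 ≤ k)
    (hkn : k ≤ Fintype.card V) {T : Finset V} (hT : T.card = k) :
    ∑ u ∈ T, F.mulVec (fun v => (costC E C v : ℝ)) u ≤ c * (costTopK E C k : ℝ) := by
  obtain ⟨S, hS, hle⟩ := exists_card_eq_sum_mul_le (fun z => ∑ u ∈ T, F u z)
    (fun v => (costC E C v : ℝ)) (c := c) hk hkn
    (fun z => (sum_le_univ_sum_of_nonneg fun u => hF.nonneg u z).trans (hF.col_le z))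
    (fun z => sum_nonneg fun u _ => hF.nonneg u z)
    (by
      rw [sum_comm]
      refine (sum_le_sum fun u _ => hF.row_le u).trans ?_
      rw [sum_const, hT, nsmul_eq_mul, mul_comm])
    (fun z => Nat.cast_nonneg _)
  have hSle : ∑ u ∈ S, costC E C u ≤ costTopK E C k :=
    le_sup (f := fun T => ∑ u ∈ T, costC E C u)
      (mem_powersetCard.2 ⟨subset_univ _, hS⟩)
  calc ∑ u ∈ T, F.mulVec (fun v => (costC E C v : ℝ)) u
      = ∑ z, (∑ u ∈ T, F u z) * (costC E C z : ℝ) := by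
        simp only [Matrix.mulVec, dotProduct, sum_mul]
        rw [sum_comm]
    _ ≤ c * ∑ z ∈ S, (costC E C z : ℝ) := hle
    _ ≤ c * (costTopK E C k : ℝ) := mul_le_mul_of_nonneg_left (by exact_mod_cast hSle) hc

end ChargeMatrices

section PrunedGraph

variable [Fintype V] {β : ℝ} {E : V → V → Prop}

theorem deg_pos (hrefl : ∀ u, E u u) (u : V) : 0 < deg E u :=
  card_pos.2 ⟨u, by simp [Nbr, hrefl u]⟩

theorem Mdeg_comm (u v : V) : Mdeg E u v = Mdeg E v u := max_comm _ _

theorem Mdeg_pos (hrefl : ∀ u, E u u) (u v : V) : 0 < Mdeg E u v :=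
  (deg_pos hrefl u).trans_le (le_max_left _ _)

theorem EH_symm (hsymm : ∀ u v, E u v → E v u) {u v : V} (h : EH β E u v) : EH β E v u :=
  ⟨hsymm _ _ h.1, by rw [symmDiff_comm, Mdeg_comm]; exact h.2⟩

theorem mem_NH {u v : V} : v ∈ NH β E u ↔ EH β E u v := by simp [NH]

theorem NH_subset_Nbr (u : V) : NH β E u ⊆ Nbr E u := fun v hv => by
  simpa [Nbr] using (mem_NH.1 hv).1

theorem card_NH_le_deg (u : V) : (NH β E u).card ≤ deg E u := card_le_card (NH_subset_Nbr u)

theorem one_sub_mul_deg_le (hβ0 : 0 < β) {u v : V} (h : EH β E u v) :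
    (1 - β) * (deg E v : ℝ) ≤ deg E u := by
  have h0 : (0 : ℝ) ≤ deg E v := Nat.cast_nonneg _
  rcases le_total (deg E v) (deg E u) with hd | hd
  · have : (deg E v : ℝ) ≤ deg E u := by exact_mod_cast hd
    nlinarith
  · have h1 : deg E v ≤ deg E u + (symmDiff (Nbr E u) (Nbr E v)).card := by
      refine (card_le_card fun w hw => ?_).trans (card_union_le _ _)
      by_cases hwu : w ∈ Nbr E u
      · exact mem_union_left _ hwu
      · exact mem_union_right _ (mem_symmDiff.2 (Or.inr ⟨hw, hwu⟩))
    have h2 := h.2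
    rw [Mdeg, max_eq_right hd] at h2
    have h3 : (deg E v : ℝ) ≤ deg E u + (symmDiff (Nbr E u) (Nbr E v)).card := by
      exact_mod_cast h1
    linarith

theorem xval_self (u : V) : xval β E u u = 0 := by simp [xval]

theorem xval_comm (u v : V) : xval β E u v = xval β E v u := by
  simp only [xval, Mdeg_comm u v, inter_comm (NH β E u), eq_comm (a := u)]

theorem xval_of_ne {u v : V} (h : u ≠ v) :
    xval β E u v = 1 - ((NH β E u ∩ NH β E v).card : ℝ) / (Mdeg E u v : ℝ) := if_neg h

theorem xval_le_one (u v : V) : xval β E u v ≤ 1 := by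
  unfold xval
  split_ifs
  · exact zero_le_one
  · linarith [show (0 : ℝ) ≤ ((NH β E u ∩ NH β E v).card : ℝ) / (Mdeg E u v : ℝ) by positivity]

theorem xval_nonneg (u v : V) : 0 ≤ xval β E u v := by
  unfold xval
  split_ifs
  · exact le_rfl
  · refine sub_nonneg.2 (div_le_one_of_le₀ ?_ (Nat.cast_nonneg _))
    exact_mod_cast (card_le_card inter_subset_left).trans
      ((card_NH_le_deg u).trans (le_max_left _ _))

theorem card_inter_add_card_inter_le (u v w : V) :
    (NH β E u ∩ NH β E v).card + (NH β E u ∩ NH β E w).card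
      ≤ deg E u + (NH β E v ∩ NH β E w).card := by
  rw [← card_union_add_card_inter]
  refine add_le_add ((card_le_card ?_).trans (card_NH_le_deg (β := β) u)) (card_le_card ?_)
  · exact union_subset inter_subset_left inter_subset_left
  · intro z hz
    simp only [mem_inter] at hz ⊢
    exact ⟨hz.1.2, hz.2.2⟩

theorem xval_triangle (hrefl : ∀ u, E u u) (u v w : V) :
    xval β E v w ≤ xval β E u v + xval β E u w := by
  wlog hvw : deg E w ≤ deg E v generalizing v w
  · rw [xval_comm v w, add_comm]
    exact this w v (le_of_not_ge hvw)
  by_cases h1 : v = w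
  · subst h1
    rw [xval_self]
    exact add_nonneg (xval_nonneg _ _) (xval_nonneg _ _)
  by_cases h2 : u = v
  · subst h2; rw [xval_self, zero_add]
  by_cases h3 : u = w
  · subst h3; rw [xval_self, add_zero, xval_comm]
  have hcard : ((NH β E u ∩ NH β E v).card : ℝ) + ((NH β E u ∩ NH β E w).card : ℝ)
      ≤ deg E u + ((NH β E v ∩ NH β E w).card : ℝ) := by
    exact_mod_cast card_inter_add_card_inter_le u v w
  have hu : (0 : ℝ) < deg E u := by exact_mod_cast deg_pos hrefl u
  have hv : (0 : ℝ) < deg E v := by exact_mod_cast deg_pos hrefl v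
  rw [xval_of_ne h1, xval_of_ne h2, xval_of_ne h3]
  have hMvw : Mdeg E v w = deg E v := max_eq_left hvw
  rw [hMvw]
  set a : ℝ := ((NH β E u ∩ NH β E v).card : ℝ)
  set b : ℝ := ((NH β E u ∩ NH β E w).card : ℝ) with hb
  set c : ℝ := ((NH β E v ∩ NH β E w).card : ℝ)
  have hc0 : 0 ≤ c := Nat.cast_nonneg _
  rcases le_total (deg E v) (deg E u) with huv | huv
  · have hMuv : Mdeg E u v = deg E u := max_eq_left huv
    have hMuw : Mdeg E u w = deg E u := max_eq_left (hvw.trans huv)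
    rw [hMuv, hMuw]
    have huv' : (deg E v : ℝ) ≤ deg E u := by exact_mod_cast huv
    have e1 : c / (deg E u : ℝ) ≤ c / (deg E v : ℝ) := div_le_div_of_nonneg_left hc0 hv huv'
    have e2 : (a + b) / (deg E u : ℝ) ≤ (deg E u + c) / (deg E u : ℝ) :=
      div_le_div_of_nonneg_right hcard hu.le
    rw [add_div, add_div, div_self hu.ne'] at e2
    linarith
  · have hMuv : Mdeg E u v = deg E v := max_eq_right huv
    rw [hMuv]
    have hr : (0 : ℝ) < Mdeg E u w := by exact_mod_cast Mdeg_pos hrefl u w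
    have hrv : (Mdeg E u w : ℝ) ≤ deg E v := by exact_mod_cast max_le huv hvw
    have hur : (deg E u : ℝ) ≤ Mdeg E u w := by exact_mod_cast le_max_left _ _
    have hbr : b ≤ Mdeg E u w := by
      refine le_trans ?_ hur
      rw [hb]
      exact_mod_cast (card_le_card inter_subset_left).trans (card_NH_le_deg u)
    have e1 : (a - c) / (deg E v : ℝ) ≤ (Mdeg E u w - b) / (deg E v : ℝ) :=
      div_le_div_of_nonneg_right (by linarith) hv.le
    have e2 : (Mdeg E u w - b) / (deg E v : ℝ) ≤ (Mdeg E u w - b) / (Mdeg E u w : ℝ) :=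
      div_le_div_of_nonneg_left (by linarith) hr hrv
    rw [sub_div, sub_div] at e1
    rw [sub_div, sub_div, div_self hr.ne'] at e2
    linarith

/-- The vertices with which `u` is in disagreement under the clustering `C`. -/
def disagree {α : Type*} (E : V → V → Prop) (C : V → α) (u : V) : Finset V :=
  univ.filter (fun v => (E u v ∧ C u ≠ C v) ∨ (¬ E u v ∧ v ≠ u ∧ C u = C v))

theorem card_disagree (C : V → ℕ) (u : V) : (disagree E C u).card = costC E C u := rfl

/-- The `+`neighbors of `u` in its own cluster whose edge to `u` is pruned. -/
def prunedNbr (β : ℝ) (E : V → V → Prop) (C : V → ℕ) (u : V) : Finset V :=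
  univ.filter (fun v => E u v ∧ C u = C v ∧ ¬ EH β E u v)

/-- The neighbors of `u` in the pruned graph that lie in its own cluster. -/
def keptNbr (β : ℝ) (E : V → V → Prop) (C : V → ℕ) (u : V) : Finset V :=
  univ.filter (fun v => C u = C v ∧ EH β E u v)

/-- The matrix with entry `1 / M_{uv}` where `v ∈ S u` and `0` elsewhere. -/
def invMdegMatrix (E : V → V → Prop) (S : V → Finset V) : Matrix V V ℝ :=
  fun u v => if v ∈ S u then ((Mdeg E u v : ℝ))⁻¹ else 0

theorem invMdegMatrix_nonneg (S : V → Finset V) (u v : V) : 0 ≤ invMdegMatrix E S u v := by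
  unfold invMdegMatrix
  split_ifs <;> positivity

theorem invMdegMatrix_symm {S : V → Finset V} (hS : ∀ u v, v ∈ S u ↔ u ∈ S v) (u v : V) :
    invMdegMatrix E S u v = invMdegMatrix E S v u := by
  simp only [invMdegMatrix, hS u v, Mdeg_comm u v]

theorem invMdegMatrix_row_sum_le (hrefl : ∀ u, E u u) (S : V → Finset V) (u : V) :
    ∑ v, invMdegMatrix E S u v ≤ (S u).card / (deg E u : ℝ) := by
  simp only [invMdegMatrix]
  rw [sum_ite_mem, univ_inter, div_eq_mul_inv, ← nsmul_eq_mul]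
  refine sum_le_card_nsmul _ _ _ fun v _ => ?_
  have : (0 : ℝ) < deg E u := by exact_mod_cast deg_pos hrefl u
  exact inv_anti₀ this (by exact_mod_cast le_max_left _ _)

theorem prunedNbr_symm (hsymm : ∀ u v, E u v → E v u) (C : V → ℕ) (u v : V) :
    v ∈ prunedNbr β E C u ↔ u ∈ prunedNbr β E C v := by
  simp only [prunedNbr, mem_filter, mem_univ, true_and]
  exact ⟨fun h => ⟨hsymm _ _ h.1, h.2.1.symm, fun h' => h.2.2 (EH_symm hsymm h')⟩,
    fun h => ⟨hsymm _ _ h.1, h.2.1.symm, fun h' => h.2.2 (EH_symm hsymm h')⟩⟩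

theorem keptNbr_symm (hsymm : ∀ u v, E u v → E v u) (C : V → ℕ) (u v : V) :
    v ∈ keptNbr β E C u ↔ u ∈ keptNbr β E C v := by
  simp only [keptNbr, mem_filter, mem_univ, true_and]
  exact ⟨fun h => ⟨h.1.symm, EH_symm hsymm h.2⟩, fun h => ⟨h.1.symm, EH_symm hsymm h.2⟩⟩

theorem kept_add_pruned_row_sum_le_one (hrefl : ∀ u, E u u) (C : V → ℕ) (u : V) :
    ∑ v, invMdegMatrix E (keptNbr β E C) u v + ∑ v, invMdegMatrix E (prunedNbr β E C) u v
      ≤ 1 := by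
  have hd : (0 : ℝ) < deg E u := by exact_mod_cast deg_pos hrefl u
  refine (add_le_add (invMdegMatrix_row_sum_le hrefl _ u)
    (invMdegMatrix_row_sum_le hrefl _ u)).trans ?_
  rw [← add_div, div_le_one hd]
  have hdisj : Disjoint (keptNbr β E C u) (prunedNbr β E C u) := by
    rw [disjoint_left]
    intro v hv hv'
    simp only [keptNbr, prunedNbr, mem_filter, mem_univ, true_and] at hv hv'
    exact hv'.2.2 hv.2
  have hcard : (keptNbr β E C u).card + (prunedNbr β E C u).card ≤ deg E u := by
    rw [← card_union_of_disjoint hdisj]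
    refine card_le_card fun v hv => ?_
    simp only [keptNbr, prunedNbr, Nbr, mem_union, mem_filter, mem_univ, true_and] at hv ⊢
    exact hv.elim (fun h => h.2.1) (fun h => h.1)
  exact_mod_cast hcard

theorem symmDiff_card_le_cost (hrefl : ∀ u, E u u) {C : V → ℕ} {u v : V}
    (hC : C u = C v) :
    (symmDiff (Nbr E u) (Nbr E v)).card ≤ costC E C u + costC E C v := by
  rw [← card_disagree, ← card_disagree]
  refine (card_le_card fun w hw => ?_).trans (card_union_le _ _)
  simp only [mem_symmDiff, Nbr, disagree, mem_union, mem_filter, mem_univ, true_and] at hw ⊢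
  have hu := hrefl u
  have hv := hrefl v
  grind

theorem one_le_cost_div (hrefl : ∀ u, E u u) (hβ0 : 0 < β) {C : V → ℕ} {u v : V}
    (h : v ∈ prunedNbr β E C u) :
    1 ≤ β⁻¹ * ((Mdeg E u v : ℝ)⁻¹ * (costC E C u + costC E C v)) := by
  simp only [prunedNbr, mem_filter, mem_univ, true_and] at h
  obtain ⟨hE, hC, hH⟩ := h
  have hM : (0 : ℝ) < Mdeg E u v := by exact_mod_cast Mdeg_pos hrefl u v
  have h1 : β * (Mdeg E u v : ℝ) < ((symmDiff (Nbr E u) (Nbr E v)).card : ℝ) :=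
    not_le.1 fun h' => hH ⟨hE, h'⟩
  have h2 : ((symmDiff (Nbr E u) (Nbr E v)).card : ℝ) ≤ costC E C u + costC E C v := by
    exact_mod_cast symmDiff_card_le_cost hrefl hC
  rw [← mul_assoc, ← mul_inv, ← div_eq_inv_mul, one_le_div (by positivity)]
  linarith

theorem card_prunedNbr_le (hrefl : ∀ u, E u u) (hβ0 : 0 < β) (C : V → ℕ) (u : V) :
    ((prunedNbr β E C u).card : ℝ)
      ≤ β⁻¹ * (signlessLap (invMdegMatrix E (prunedNbr β E C))).mulVec
          (fun v => (costC E C v : ℝ)) u := by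
  rw [signlessLap_mulVec, mul_sum, card_eq_sum_ones, Nat.cast_sum, ← univ_inter (prunedNbr β E C u),
    ← sum_ite_mem]
  refine sum_le_sum fun v _ => ?_
  by_cases h : v ∈ prunedNbr β E C u
  · simpa [invMdegMatrix, h] using one_le_cost_div hrefl hβ0 h
  · simp [invMdegMatrix, h]

theorem Mdeg_le_of_same_cluster (hrefl : ∀ u, E u u) {C : V → ℕ} {u v : V} (hC : C u = C v) :
    Mdeg E u v ≤ (NH β E u ∩ NH β E v).card + (costC E C u + costC E C v
      + ((prunedNbr β E C u).card + (prunedNbr β E C v).card)) := by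
  have hsub : ∀ w, E u w ∨ E v w → w ∈ (NH β E u ∩ NH β E v)
      ∪ ((disagree E C u ∪ disagree E C v) ∪ (prunedNbr β E C u ∪ prunedNbr β E C v)) := by
    intro w hw
    simp only [mem_union, mem_inter, mem_NH, disagree, prunedNbr, mem_filter, mem_univ, true_and]
    have hu := hrefl u
    have hv := hrefl v
    grind
  have hcard : ((NH β E u ∩ NH β E v) ∪ ((disagree E C u ∪ disagree E C v)
      ∪ (prunedNbr β E C u ∪ prunedNbr β E C v))).card
      ≤ (NH β E u ∩ NH β E v).card + (costC E C u + costC E C v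
      + ((prunedNbr β E C u).card + (prunedNbr β E C v).card)) := by
    rw [← card_disagree, ← card_disagree]
    refine (card_union_le _ _).trans (Nat.add_le_add_left ((card_union_le _ _).trans ?_) _)
    exact add_le_add (card_union_le _ _) (card_union_le _ _)
  refine max_le ?_ ?_
  · refine (card_le_card fun w hw => hsub w (Or.inl ?_)).trans hcard
    simpa [Nbr] using hw
  · refine (card_le_card fun w hw => hsub w (Or.inr ?_)).trans hcard
    simpa [Nbr] using hw

theorem xval_le_of_kept (hrefl : ∀ u, E u u) {C : V → ℕ} {u v : V} (hC : C u = C v) :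
    xval β E u v ≤ (Mdeg E u v : ℝ)⁻¹ * ((costC E C u + costC E C v : ℝ)
      + ((prunedNbr β E C u).card + (prunedNbr β E C v).card)) := by
  by_cases huv : u = v
  · subst huv
    rw [xval_self]
    positivity
  have hM : (0 : ℝ) < Mdeg E u v := by exact_mod_cast Mdeg_pos hrefl u v
  have h : (Mdeg E u v : ℝ) ≤ (NH β E u ∩ NH β E v).card + ((costC E C u + costC E C v : ℝ)
      + ((prunedNbr β E C u).card + (prunedNbr β E C v).card)) := by
    exact_mod_cast Mdeg_le_of_same_cluster hrefl hC
  rw [xval_of_ne huv, ← div_eq_inv_mul, one_sub_div hM.ne']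
  exact div_le_div_of_nonneg_right (by linarith) hM.le

/-- The cost of the `+`edges inside a cluster. -/
theorem sum_xval_same_cluster_le (hrefl : ∀ u, E u u) (hβ0 : 0 < β) (hβ1 : β < 1)
    (C : V → ℕ) (u : V) :
    ∑ v, (if E u v ∧ C u = C v then xval β E u v else 0)
      ≤ (β⁻¹ • ((signlessLap (invMdegMatrix E (keptNbr β E C))
            + signlessLap (invMdegMatrix E (prunedNbr β E C)))
          + signlessLap (invMdegMatrix E (keptNbr β E C))
            * signlessLap (invMdegMatrix E (prunedNbr β E C)))).mulVec
          (fun v => (costC E C v : ℝ)) u := by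
  set y : V → ℝ := fun v => (costC E C v : ℝ)
  set K := invMdegMatrix E (keptNbr β E C) with hK
  set P := invMdegMatrix E (prunedNbr β E C) with hP
  have hβ : 1 ≤ β⁻¹ := (one_le_inv₀ hβ0).2 hβ1.le
  have hpt : ∀ v, (if E u v ∧ C u = C v then xval β E u v else 0)
      ≤ β⁻¹ * (K u v * (y u + y v)) + β⁻¹ * (P u v * (y u + y v))
        + K u v * (β⁻¹ * (signlessLap P).mulVec y u + β⁻¹ * (signlessLap P).mulVec y v) := by
    intro v
    have hpu := card_prunedNbr_le hrefl hβ0 C u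
    have hpv := card_prunedNbr_le hrefl hβ0 C v
    have hp0 : (0 : ℝ) ≤ (prunedNbr β E C u).card := Nat.cast_nonneg _
    have hp0' : (0 : ℝ) ≤ (prunedNbr β E C v).card := Nat.cast_nonneg _
    have hK0 : 0 ≤ K u v := invMdegMatrix_nonneg _ _ _
    have hP0 : 0 ≤ P u v := invMdegMatrix_nonneg _ _ _
    have hyy : 0 ≤ y u + y v := add_nonneg (Nat.cast_nonneg _) (Nat.cast_nonneg _)
    have t1 : K u v * (y u + y v) ≤ β⁻¹ * (K u v * (y u + y v)) :=
      le_mul_of_one_le_left (mul_nonneg hK0 hyy) hβ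
    have t2 : 0 ≤ β⁻¹ * (P u v * (y u + y v)) := by positivity
    have t3 : K u v * ((prunedNbr β E C u).card + (prunedNbr β E C v).card : ℝ)
        ≤ K u v * (β⁻¹ * (signlessLap P).mulVec y u + β⁻¹ * (signlessLap P).mulVec y v) :=
      mul_le_mul_of_nonneg_left (add_le_add hpu hpv) hK0
    have t0 : 0 ≤ K u v * (y u + y v) := mul_nonneg hK0 hyy
    have t4 : 0 ≤ K u v * ((prunedNbr β E C u).card + (prunedNbr β E C v).card : ℝ) :=
      mul_nonneg hK0 (add_nonneg hp0 hp0')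
    split_ifs with h
    · by_cases hH : EH β E u v
      · have hKv : K u v = (Mdeg E u v : ℝ)⁻¹ := by simp [hK, invMdegMatrix, keptNbr, h.2, hH]
        have := xval_le_of_kept (β := β) hrefl h.2
        rw [← hKv, mul_add] at this
        linarith
      · have hmem : v ∈ prunedNbr β E C u := by simp [prunedNbr, h.1, h.2, hH]
        have hPv : P u v = (Mdeg E u v : ℝ)⁻¹ := by simp [hP, invMdegMatrix, hmem]
        have := one_le_cost_div hrefl hβ0 hmem
        rw [← hPv] at this
        linarith [xval_le_one (β := β) (E := E) u v]
    · linarith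
  refine (sum_le_sum fun v _ => hpt v).trans_eq ?_
  rw [Matrix.smul_mulVec, Matrix.add_mulVec, Matrix.add_mulVec, ← Matrix.mulVec_mulVec]
  simp only [Pi.smul_apply, Pi.add_apply, smul_eq_mul]
  rw [signlessLap_mulVec K ((signlessLap P).mulVec y) u, signlessLap_mulVec K y u,
    sum_add_distrib, sum_add_distrib, ← mul_sum, ← mul_sum, ← signlessLap_mulVec P y u, mul_add,
    mul_add]
  congr 1
  rw [mul_sum]
  exact sum_congr rfl fun v _ => by ring

/-- The matrix averaging over the pruned neighborhood, normalized by the degree. -/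
def averagingMatrix (β : ℝ) (E : V → V → Prop) : Matrix V V ℝ :=
  fun u w => if w ∈ NH β E u then ((deg E u : ℝ))⁻¹ else 0

theorem isChargeMatrix_averagingMatrix (hsymm : ∀ u v, E u v → E v u) (hrefl : ∀ u, E u u)
    (hβ0 : 0 < β) (hβ1 : β < 1) : IsChargeMatrix (averagingMatrix β E) (1 - β)⁻¹ where
  nonneg u w := by
    unfold averagingMatrix
    split_ifs <;> positivity
  row_le u := by
    have hd : (0 : ℝ) < deg E u := by exact_mod_cast deg_pos hrefl u
    have hc : ((NH β E u).card : ℝ) ≤ deg E u := by exact_mod_cast card_NH_le_deg u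
    simp only [averagingMatrix]
    rw [sum_ite_mem, univ_inter, sum_const, nsmul_eq_mul, ← div_eq_mul_inv]
    refine ((div_le_one hd).2 hc).trans ((one_le_inv₀ (by linarith)).2 (by linarith))
  col_le w := by
    have hd : (0 : ℝ) < deg E w := by exact_mod_cast deg_pos hrefl w
    have hc : ((NH β E w).card : ℝ) ≤ deg E w := by exact_mod_cast card_NH_le_deg w
    have hβ' : 0 < 1 - β := by linarith
    have hpt : ∀ u, averagingMatrix β E u w
        ≤ if u ∈ NH β E w then ((1 - β) * (deg E w : ℝ))⁻¹ else 0 := by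
      intro u
      by_cases h : EH β E u w
      · have h' := EH_symm hsymm h
        simp only [averagingMatrix, mem_NH, h, h', if_true]
        exact inv_anti₀ (by positivity) (one_sub_mul_deg_le hβ0 h)
      · have h' : ¬ EH β E w u := fun h' => h (EH_symm hsymm h')
        simp [averagingMatrix, mem_NH, h, h']
    refine (sum_le_sum fun u _ => hpt u).trans ?_
    rw [sum_ite_mem, univ_inter, sum_const, nsmul_eq_mul, mul_inv]
    have : ((NH β E w).card : ℝ) * (deg E w : ℝ)⁻¹ ≤ 1 := by
      rw [← div_eq_mul_inv]; exact (div_le_one hd).2 hc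
    calc ((NH β E w).card : ℝ) * ((1 - β)⁻¹ * (deg E w : ℝ)⁻¹)
        = (1 - β)⁻¹ * ((NH β E w).card * (deg E w : ℝ)⁻¹) := by ring
      _ ≤ (1 - β)⁻¹ * 1 := mul_le_mul_of_nonneg_left this (by positivity)
      _ = (1 - β)⁻¹ := mul_one _

/-- The cost of the `-`edges between clusters. -/
theorem sum_one_sub_xval_diff_cluster_le (hsymm : ∀ u v, E u v → E v u) (hrefl : ∀ u, E u u)
    (hβ0 : 0 < β) (hβ1 : β < 1) (C : V → ℕ) (u : V) :
    ∑ v, (if ¬ E u v ∧ C u ≠ C v then 1 - xval β E u v else 0)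
      ≤ ((1 - β)⁻¹ • (1 : Matrix V V ℝ) + averagingMatrix β E).mulVec
          (fun v => (costC E C v : ℝ)) u := by
  have hβ' : 0 < 1 - β := by linarith
  have hdu : (0 : ℝ) < deg E u := by exact_mod_cast deg_pos hrefl u
  have hpt : ∀ v, (if ¬ E u v ∧ C u ≠ C v then 1 - xval β E u v else 0)
      ≤ ∑ w ∈ NH β E u, (deg E u : ℝ)⁻¹ * ((if C u ≠ C w then
          (if v ∈ NH β E w then 1 else 0) else 0) + (if v ∈ disagree E C w then 1 else 0)) := by
    intro v
    split_ifs with h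
    · have huv : u ≠ v := fun h' => h.2 (by rw [h'])
      have hdM : (deg E u : ℝ) ≤ Mdeg E u v := by exact_mod_cast le_max_left _ _
      rw [xval_of_ne huv, sub_sub_cancel]
      refine (div_le_div_of_nonneg_left (Nat.cast_nonneg _) hdu hdM).trans ?_
      rw [← mul_sum, div_eq_inv_mul]
      refine mul_le_mul_of_nonneg_left ?_ (by positivity)
      rw [card_eq_sum_ones, Nat.cast_sum, ← sum_ite_mem]
      refine sum_le_sum fun w _ => ?_
      by_cases hw : w ∈ NH β E v
      · have hwv : EH β E w v := EH_symm hsymm (mem_NH.1 hw)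
        have hwv' : v ∈ NH β E w := mem_NH.2 hwv
        by_cases hc : C u = C w
        · have : v ∈ disagree E C w := by
            simp only [disagree, mem_filter, mem_univ, true_and]
            exact Or.inl ⟨hwv.1, fun h' => h.2 (hc.trans h')⟩
          simp [hw, hc, this]
        · simp only [hw, hwv', hc, if_true, ne_eq, not_false_eq_true]
          split_ifs <;> norm_num
      · rw [if_neg hw]
        split_ifs <;> norm_num
    · refine sum_nonneg fun w _ => mul_nonneg (by positivity) ?_
      split_ifs <;> norm_num
  refine (sum_le_sum fun v _ => hpt v).trans ?_
  rw [sum_comm]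
  simp only [← mul_sum, sum_add_distrib, mul_add]
  rw [Matrix.add_mulVec, Matrix.smul_mulVec, Matrix.one_mulVec]
  simp only [Pi.add_apply, Pi.smul_apply, smul_eq_mul]
  refine add_le_add ?_ (le_of_eq ?_)
  · have hcut : ((univ.filter fun w => EH β E u w ∧ C u ≠ C w).card : ℝ) ≤ costC E C u := by
      rw [← card_disagree]
      exact_mod_cast card_le_card fun w hw => by
        simp only [disagree, mem_filter, mem_univ, true_and] at hw ⊢
        exact Or.inl ⟨hw.1.1, hw.2⟩
    have hw : ∀ w ∈ NH β E u, (deg E u : ℝ)⁻¹ * ∑ v, (if C u ≠ C w then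
        (if v ∈ NH β E w then (1 : ℝ) else 0) else 0)
        ≤ if C u ≠ C w then (1 - β)⁻¹ else 0 := by
      intro w hw
      split_ifs with hc
      · have hle : ((NH β E w).card : ℝ) ≤ deg E w := by exact_mod_cast card_NH_le_deg w
        have hdeg := one_sub_mul_deg_le hβ0 (mem_NH.1 hw)
        rw [sum_ite_mem, univ_inter, sum_const, nsmul_eq_mul, mul_one, ← div_eq_inv_mul,
          div_le_iff₀ hdu, ← div_eq_inv_mul, le_div_iff₀ hβ']
        nlinarith
      · simp
    rw [mul_sum]
    refine (sum_le_sum hw).trans ?_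
    rw [← sum_filter, sum_const, nsmul_eq_mul, mul_comm, NH, filter_filter]
    exact mul_le_mul_of_nonneg_left hcut (by positivity)
  · simp only [Matrix.mulVec, dotProduct, averagingMatrix, ite_mul, zero_mul]
    rw [sum_ite_mem, univ_inter, mul_sum]
    refine sum_congr rfl fun w _ => ?_
    simp [sum_ite_mem, card_disagree]

/-- The matrix distributing the fractional cost of each vertex over the clustering costs. -/
def chargeMatrix (β : ℝ) (E : V → V → Prop) (C : V → ℕ) : Matrix V V ℝ :=
  1 + β⁻¹ • ((signlessLap (invMdegMatrix E (keptNbr β E C))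
            + signlessLap (invMdegMatrix E (prunedNbr β E C)))
          + signlessLap (invMdegMatrix E (keptNbr β E C))
            * signlessLap (invMdegMatrix E (prunedNbr β E C)))
    + ((1 - β)⁻¹ • (1 : Matrix V V ℝ) + averagingMatrix β E)

theorem isChargeMatrix_chargeMatrix (hsymm : ∀ u v, E u v → E v u) (hrefl : ∀ u, E u u)
    (hβ0 : 0 < β) (hβ1 : β < 1) (C : V → ℕ) :
    IsChargeMatrix (chargeMatrix β E C) (1 + 4 / β + 2 / (1 - β)) := by
  have hβ' : 0 < 1 - β := by linarith
  have hK := invMdegMatrix_nonneg (E := E) (keptNbr β E C)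
  have hP := invMdegMatrix_nonneg (E := E) (prunedNbr β E C)
  have hKs := invMdegMatrix_symm (E := E) (keptNbr_symm (β := β) hsymm C)
  have hPs := invMdegMatrix_symm (E := E) (prunedNbr_symm (β := β) hsymm C)
  have hKP := kept_add_pruned_row_sum_le_one (β := β) hrefl C
  have h := (isChargeMatrix_one.add (((isChargeMatrix_signlessLap_add hK hP hKs hPs hKP).add
    (isChargeMatrix_signlessLap_mul hK hP hKs hPs hKP)).smul (inv_nonneg.2 hβ0.le))).add
    ((isChargeMatrix_one.smul (inv_nonneg.2 hβ'.le)).add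
      (isChargeMatrix_averagingMatrix hsymm hrefl hβ0 hβ1))
  have hc : 1 + 4 / β + 2 / (1 - β)
      = 1 + β⁻¹ * (2 + 2) + ((1 - β)⁻¹ * 1 + (1 - β)⁻¹) := by
    rw [div_eq_mul_inv, div_eq_mul_inv]; ring
  rw [hc]
  exact h

theorem costX_le_chargeMatrix_mulVec (hsymm : ∀ u v, E u v → E v u) (hrefl : ∀ u, E u u)
    (hβ0 : 0 < β) (hβ1 : β < 1) (C : V → ℕ) (u : V) :
    costX E (xval β E) u ≤ (chargeMatrix β E C).mulVec (fun v => (costC E C v : ℝ)) u := by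
  have hsplit : costX E (xval β E) u ≤ ∑ v, (if v ∈ disagree E C u then (1 : ℝ) else 0)
      + ∑ v, (if E u v ∧ C u = C v then xval β E u v else 0)
      + ∑ v, (if ¬ E u v ∧ C u ≠ C v then 1 - xval β E u v else 0) := by
    rw [costX, sum_filter, sum_filter, ← sum_add_distrib, ← sum_add_distrib, ← sum_add_distrib]
    refine sum_le_sum fun v _ => ?_
    have h0 := xval_nonneg (β := β) (E := E) u v
    have h1 := xval_le_one (β := β) (E := E) u v
    simp only [disagree, mem_filter, mem_univ, true_and]
    by_cases hE : E u v <;> by_cases hC : C u = C v <;> by_cases hv : v = u <;>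
      simp [hE, hC, hv] <;> linarith
  have hD : ∑ v, (if v ∈ disagree E C u then (1 : ℝ) else 0) = costC E C u := by
    simp [sum_ite_mem, card_disagree]
  rw [hD] at hsplit
  rw [chargeMatrix, Matrix.add_mulVec, Matrix.add_mulVec, Matrix.one_mulVec]
  exact hsplit.trans (add_le_add (add_le_add le_rfl (sum_xval_same_cluster_le hrefl hβ0 hβ1 C u))
    (sum_one_sub_xval_diff_cluster_le hsymm hrefl hβ0 hβ1 C u))

theorem costXTopK_xval_le (hsymm : ∀ u v, E u v → E v u) (hrefl : ∀ u, E u u)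
    (hβ0 : 0 < β) (hβ1 : β < 1) (C : V → ℕ) {k : ℕ} (hk : 1 ≤ k) (hkn : k ≤ Fintype.card V) :
    costXTopK E (xval β E) k ≤ (1 + 4 / β + 2 / (1 - β)) * (costTopK E C k : ℝ) := by
  have hne : (powersetCard k (univ : Finset V)).Nonempty :=
    powersetCard_nonempty.2 (by simpa using hkn)
  have hβ' : 0 < 1 - β := by linarith
  rw [costXTopK, dif_pos hne]
  refine sup'_le _ _ fun T hT => ?_
  refine (sum_le_sum fun u _ => costX_le_chargeMatrix_mulVec hsymm hrefl hβ0 hβ1 C u).trans ?_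
  exact (isChargeMatrix_chargeMatrix hsymm hrefl hβ0 hβ1 C).sum_mulVec_le_costTopK
    (by positivity) hk hkn (mem_powersetCard.1 hT).2

end PrunedGraph

/-- For every clustering `𝒞` and every `k ∈ [n]`,
`cost^k_x ≤ (1 + 4/β + 2/(1−β))·cost^k_𝒞`; in particular, taking `β = 0.5858`,
the solution `x` is feasible for the metric LP and `cost^k_x ≤ 12.66·opt^k`. -/
theorem costXTopK_le [Fintype V] (E : V → V → Prop)
    (hsymm : ∀ u v, E u v → E v u) (hrefl : ∀ u, E u u)
    (β : ℝ) (hβ0 : 0 < β) (hβ1 : β < 1) :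
    (∀ (C : V → ℕ) (k : ℕ), 1 ≤ k → k ≤ Fintype.card V →
        costXTopK E (xval β E) k
          ≤ (1 + 4 / β + 2 / (1 - β)) * (costTopK E C k : ℝ)) ∧
    ((∀ u v w : V, xval 0.5858 E v w ≤ xval 0.5858 E u v + xval 0.5858 E u w) ∧
      (∀ u v : V, 0 ≤ xval 0.5858 E u v ∧ xval 0.5858 E u v ≤ 1) ∧
      (∀ u : V, xval 0.5858 E u u = 0) ∧
      (∀ (C : V → ℕ) (k : ℕ), 1 ≤ k → k ≤ Fintype.card V →
        costXTopK E (xval 0.5858 E) k ≤ 12.66 * (costTopK E C k : ℝ))) := by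
  refine ⟨fun C k hk hkn => costXTopK_xval_le hsymm hrefl hβ0 hβ1 C hk hkn,
    fun u v w => xval_triangle hrefl u v w, fun u v => ⟨xval_nonneg u v, xval_le_one u v⟩,
    xval_self, fun C k hk hkn => ?_⟩
  refine (costXTopK_xval_le hsymm hrefl (by norm_num) (by norm_num) C hk hkn).trans ?_
  exact mul_le_mul_of_nonneg_right (by norm_num) (Nat.cast_nonneg _)

end
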